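/- For every integer k ≥ 0 and n = 6k + 2, the star graph on (3n² − 2n + 10)/6 = 18k² + 10k + 3 vertices is a vertex-minor of the n×n grid graph. -/

import Mathlib

/-- A finite simple graph with an explicit vertex set inside an ambient type `α`. -/
structure FGraph (α : Type*) where
  verts : Set α
  Adj : α → α → Prop
  symm : ∀ {a b}, Adj a b → Adj b a
  loopless : ∀ a, ¬ Adj a a
  edge_mem : ∀ {a b}, Adj a b → a ∈ verts ∧ b ∈ verts

namespace FGraph

variable {α : Type*}

/-- Local complementation at `v`: two distinct vertices are adjacent iff exactly one of
(adjacent in `G`) or (both neighbours of `v` in `G`) holds. -/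
def LC (G : FGraph α) (v : α) : FGraph α where
  verts := G.verts
  Adj a b := a ≠ b ∧ Xor' (G.Adj a b) (G.Adj v a ∧ G.Adj v b)
  symm := by
    rintro a b ⟨hne, h⟩
    refine ⟨hne.symm, ?_⟩
    rcases h with ⟨h1, h2⟩ | ⟨h1, h2⟩
    · exact Or.inl ⟨G.symm h1, fun hx => h2 ⟨hx.2, hx.1⟩⟩
    · exact Or.inr ⟨⟨h1.2, h1.1⟩, fun hx => h2 (G.symm hx)⟩
  loopless := fun a h => h.1 rfl
  edge_mem := by
    rintro a b ⟨hne, h⟩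
    rcases h with ⟨h1, _⟩ | ⟨⟨ha, hb⟩, _⟩
    · exact G.edge_mem h1
    · exact ⟨(G.edge_mem ha).2, (G.edge_mem hb).2⟩

/-- Z measurement at `v`: delete the vertex `v` together with all incident edges. -/
def ZM (G : FGraph α) (v : α) : FGraph α where
  verts := G.verts \ {v}
  Adj a b := G.Adj a b ∧ a ≠ v ∧ b ≠ v
  symm := fun h => ⟨G.symm h.1, h.2.2, h.2.1⟩
  loopless := fun a h => G.loopless a h.1
  edge_mem := by
    rintro a b ⟨h, ha, hb⟩
    exact ⟨⟨(G.edge_mem h).1, ha⟩, ⟨(G.edge_mem h).2, hb⟩⟩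

/-- X measurement at `u` with chosen neighbour `w`:
`X_u(G) = LC_w(Z_u(LC_u(LC_w(G))))`. -/
def XM (G : FGraph α) (u w : α) : FGraph α :=
  ((((G.LC w).LC u).ZM u).LC w)

/-- Y measurement at `v`: `Y_v(G) = Z_v(LC_v(G))`. -/
def YM (G : FGraph α) (v : α) : FGraph α :=
  (G.LC v).ZM v

/-- `G` is a star graph with centre `c`. -/
def IsStar (G : FGraph α) (c : α) : Prop :=
  c ∈ G.verts ∧
    ∀ a b, G.Adj a b ↔ (a ≠ b ∧ a ∈ G.verts ∧ b ∈ G.verts ∧ (a = c ∨ b = c))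

/-- `G` is a complete graph on its vertex set. -/
def IsComplete (G : FGraph α) : Prop :=
  ∀ a b, G.Adj a b ↔ (a ≠ b ∧ a ∈ G.verts ∧ b ∈ G.verts)

/-- One step of local complementation or vertex deletion. -/
inductive Step : FGraph α → FGraph α → Prop
  | lc (G : FGraph α) (v : α) : Step G (G.LC v)
  | del (G : FGraph α) (v : α) : Step G (G.ZM v)

/-- `H` is a vertex-minor of `G`: `H` is obtained from `G` by a finite sequence of
local complementations and vertex deletions. -/
def IsVertexMinor (H G : FGraph α) : Prop :=
  Relation.ReflTransGen Step G H

/-- One step of local complementation. -/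
inductive LCStep : FGraph α → FGraph α → Prop
  | lc (G : FGraph α) (v : α) : LCStep G (G.LC v)

/-- `H` is obtained from `G` by a finite sequence of local complementations. -/
def LCReach (G H : FGraph α) : Prop :=
  Relation.ReflTransGen LCStep G H

end FGraph

/-- The `n × n` grid graph: vertices `{0,…,n-1} × {0,…,n-1}`, two vertices being
adjacent iff they agree in one coordinate and differ by exactly 1 in the other. -/
def gridGraph (n : ℕ) : FGraph (ℕ × ℕ) where
  verts := {p | p.1 < n ∧ p.2 < n}
  Adj p q := p.1 < n ∧ p.2 < n ∧ q.1 < n ∧ q.2 < n ∧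
    ((p.1 = q.1 ∧ (p.2 + 1 = q.2 ∨ q.2 + 1 = p.2)) ∨
     (p.2 = q.2 ∧ (p.1 + 1 = q.1 ∨ q.1 + 1 = p.1)))
  symm := by
    rintro p q ⟨h1, h2, h3, h4, (⟨he, hd⟩ | ⟨he, hd⟩)⟩
    · exact ⟨h3, h4, h1, h2, Or.inl ⟨he.symm, hd.symm⟩⟩
    · exact ⟨h3, h4, h1, h2, Or.inr ⟨he.symm, hd.symm⟩⟩
  loopless := by
    rintro p ⟨_, _, _, _, (⟨_, hd⟩ | ⟨_, hd⟩)⟩ <;> omega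
  edge_mem := by
    rintro p q ⟨h1, h2, h3, h4, _⟩
    exact ⟨⟨h1, h2⟩, ⟨h3, h4⟩⟩

namespace FGraph

variable {α : Type*}

theorem IsVertexMinor.refl (G : FGraph α) : IsVertexMinor G G :=
  Relation.ReflTransGen.refl

theorem IsVertexMinor.trans {G H K : FGraph α} (h : IsVertexMinor K H)
    (hGH : IsVertexMinor H G) : IsVertexMinor K G :=
  Relation.ReflTransGen.trans hGH h

/-- Deleting a finite set of vertices yields the induced subgraph as a vertex-minor. -/
theorem exists_isVertexMinor_delete (G : FGraph α) (F : Finset α) :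
    ∃ H : FGraph α, IsVertexMinor H G ∧ H.verts = G.verts \ F ∧
      ∀ a b, H.Adj a b ↔ G.Adj a b ∧ a ∉ F ∧ b ∉ F := by
  classical
  induction F using Finset.induction_on with
  | empty => exact ⟨G, .refl G, by simp, by simp⟩
  | insert v F _ ih =>
    obtain ⟨H, hHG, hv, hadj⟩ := ih
    refine ⟨H.ZM v, hHG.tail (.del H v), ?_, ?_⟩
    · ext x
      simp only [ZM, hv, Set.mem_sdiff, Set.mem_singleton_iff, Finset.coe_insert,
        Set.mem_insert_iff, Finset.mem_coe]
      tauto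
    · intro a b
      simp only [ZM, hadj, Finset.mem_insert]
      tauto

/-- If `e` has exactly the two neighbours `c` and `t`, and these are not adjacent, then `e` can be
removed so that `t` becomes a leaf at `c` and the neighbourhood of `c` becomes the symmetric
difference of those of `c` and `t`. -/
theorem exists_isVertexMinor_merge (G : FGraph α) {c t e : α}
    (hne : c ≠ t) (he : ∀ x, G.Adj e x ↔ x = c ∨ x = t) (hct : ¬ G.Adj c t) :
    ∃ H : FGraph α, IsVertexMinor H G ∧ H.verts = G.verts \ {e} ∧
      (∀ b, H.Adj t b ↔ b = c) ∧
      (∀ b, b ≠ e → b ≠ t → (H.Adj c b ↔ Xor (G.Adj c b) (G.Adj t b))) ∧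
      (∀ a b, a ≠ c → a ≠ t → a ≠ e → b ≠ c → b ≠ t → b ≠ e → (H.Adj a b ↔ G.Adj a b)) := by
  have hec : e ≠ c := fun h => G.loopless e ((he e).2 (Or.inl h))
  have het : e ≠ t := fun h => G.loopless e ((he e).2 (Or.inr h))
  have hte : G.Adj t e := G.symm ((he t).2 (Or.inr rfl))
  have htc : ¬ G.Adj t c := fun h => hct (G.symm h)
  have htt := G.loopless t
  have hcc := G.loopless c
  have hLCt : ∀ a, (G.LC t).Adj e a ↔ a ≠ e ∧ (a = c ∨ a = t ∨ G.Adj t a) := by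
    intro a
    change e ≠ a ∧ Xor (G.Adj e a) (G.Adj t e ∧ G.Adj t a) ↔ _
    simp only [he, xor_def, hte, true_and]
    by_cases h1 : a = c
    · subst h1; tauto
    by_cases h2 : a = t
    · subst h2; tauto
    have : e ≠ a ↔ a ≠ e := ne_comm
    tauto
  have hadj : ∀ a b, (((G.LC t).LC e).ZM e).Adj a b ↔
      (a ≠ b ∧ Xor (a ≠ b ∧ Xor (G.Adj a b) (G.Adj t a ∧ G.Adj t b))
        ((a ≠ e ∧ (a = c ∨ a = t ∨ G.Adj t a)) ∧ (b ≠ e ∧ (b = c ∨ b = t ∨ G.Adj t b)))) ∧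
      a ≠ e ∧ b ≠ e := by
    intro a b
    rw [← hLCt, ← hLCt]
    rfl
  refine ⟨((G.LC t).LC e).ZM e,
    (((Relation.ReflTransGen.single (.lc G t)).tail (.lc _ e)).tail (.del _ e)), rfl, ?_, ?_, ?_⟩
  · intro b
    rw [hadj]
    by_cases h1 : b = c
    · subst h1; simp [xor_def, htt, htc, hne.symm, hec.symm, het.symm]
    by_cases h2 : b = t
    · subst h2; simp [hne.symm]
    have : t ≠ b := fun h => h2 h.symm
    simp only [xor_def]
    tauto
  · intro b hbe hbt
    rw [hadj]
    by_cases h1 : b = c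
    · subst h1; simp [xor_def, hcc, htc]
    have : c ≠ b := fun h => h1 h.symm
    simp only [xor_def]
    tauto
  · intro a b h1 h2 h3 h4 h5 h6
    rw [hadj]
    by_cases hab : a = b
    · subst hab; simp [G.loopless]
    simp only [xor_def]
    tauto

/-- Let `G` be bipartite with classes `T` and `A`, and suppose that `T` carries a tree rooted at
`c` with parent function `p` such that each non-root `t` is joined to `p t` by a vertex `e t` of `A`
whose only neighbours are `t` and `p t`. Then the non-root vertices in `s` can be merged into `c`,
at the cost of the connecting vertices `e t`. -/
theorem exists_isVertexMinor_merge_finset [DecidableEq α] (G : FGraph α)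
    [DecidableRel G.Adj] (T A s : Finset α)
    (c : α) (e p : α → α) (r : α → ℕ) (hdisj : Disjoint T A) (hc : c ∈ T)
    (hverts : G.verts = T ∪ A) (hT : ∀ x ∈ T, ∀ y ∈ T, ¬ G.Adj x y)
    (hA : ∀ x ∈ A, ∀ y ∈ A, ¬ G.Adj x y)
    (he : ∀ t ∈ T, t ≠ c → e t ∈ A) (hr : ∀ t ∈ T, t ≠ c → r (p t) < r t)
    (hadj : ∀ t ∈ T, t ≠ c → ∀ x ∈ T, G.Adj x (e t) ↔ x = t ∨ x = p t)
    (hs : s ⊆ T) (hcs : c ∉ s) (hps : ∀ t ∈ s, p t ∈ insert c s) :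
    ∃ H : FGraph α, IsVertexMinor H G ∧ H.verts = (T ∪ A \ s.image e : Finset α) ∧
      (s.image e).card = s.card ∧
      (∀ t ∈ s, ∀ b, H.Adj t b ↔ b = c) ∧
      (∀ b ∈ A \ s.image e, H.Adj c b ↔ Odd ((insert c s).filter (G.Adj · b)).card) ∧
      (∀ t ∈ T, t ≠ c → t ∉ s → ∀ b ∈ A \ s.image e, H.Adj t b ↔ G.Adj t b) ∧
      (∀ x ∈ T, ∀ y ∈ T, x ∉ s → y ∉ s → ¬ H.Adj x y) ∧
      (∀ x ∈ A, ∀ y ∈ A, ¬ H.Adj x y) := by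
  have hTA : ∀ x ∈ T, x ∉ A := fun _ hx => Finset.disjoint_left.mp hdisj hx
  induction s using Finset.induction_on_max_value r with
  | empty =>
    refine ⟨G, .refl G, by simp [hverts], by simp, by simp, ?_, by simp, by simpa using hT, hA⟩
    intro b hb
    by_cases h : G.Adj c b <;> simp [Finset.filter_singleton, h]
  | insert t s hts hmax ih =>
    obtain ⟨htT, hsT⟩ := Finset.insert_subset_iff.mp hs
    have htc : t ≠ c := fun h => hcs (by simp [h])
    have hcs' : c ∉ s := fun h => hcs (by simp [h])
    have hps' : ∀ x ∈ s, p x ∈ insert c s := by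
      intro x hx
      have hx' := hps x (Finset.mem_insert_of_mem hx)
      have hxc : x ≠ c := fun h => hcs' (h ▸ hx)
      have hlt := hr x (hsT hx) hxc
      have hle := hmax x hx
      have hne : p x ≠ t := by rintro h; rw [h] at hlt; omega
      simp only [Finset.mem_insert] at hx' ⊢
      tauto
    obtain ⟨K, hKG, hKv, hcard, hleaf, hcen, hrest, hKT, hKA⟩ := ih hsT hcs' hps'
    have hpt : p t ∈ insert c s := by
      have h1 := hps t (Finset.mem_insert_self _ _)
      have h2 := hr t htT htc
      have hne : p t ≠ t := by rintro h; rw [h] at h2; omega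
      simp only [Finset.mem_insert] at h1 ⊢
      tauto
    have hptT : p t ∈ T := by
      rcases Finset.mem_insert.mp hpt with h | h
      · exact h ▸ hc
      · exact hsT h
    have hetA := he t htT htc
    have hets : e t ∉ s.image e := by
      intro h
      obtain ⟨x, hx, hxe⟩ := Finset.mem_image.mp h
      have hxc : x ≠ c := fun h => hcs' (h ▸ hx)
      have h1 := (hadj x (hsT hx) hxc t htT).mp (by rw [hxe, hadj t htT htc t htT]; simp)
      rcases h1 with h1 | h1
      · exact hts (h1 ▸ hx)
      · have h2 := hr x (hsT hx) hxc
        have h3 := hmax x hx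
        rw [← h1] at h2
        omega
    have hKet : ∀ x, K.Adj (e t) x ↔ x = c ∨ x = t := by
      have hmem : e t ∈ A \ s.image e := by simp [hetA, hets]
      have hcet : K.Adj c (e t) := by
        rw [hcen _ hmem]
        have : (insert c s).filter (G.Adj · (e t)) = {p t} := by
          ext x
          simp only [Finset.mem_filter, Finset.mem_singleton]
          constructor
          · rintro ⟨hx, hx'⟩
            have hxT : x ∈ T := by
              rcases Finset.mem_insert.mp hx with h | h
              · exact h ▸ hc
              · exact hsT h
            rcases (hadj t htT htc x hxT).mp hx' with h | h
            · subst h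
              simp only [Finset.mem_insert] at hx
              tauto
            · exact h
          · rintro rfl
            exact ⟨hpt, (hadj t htT htc _ hptT).mpr (Or.inr rfl)⟩
        simp [this]
      have htet : K.Adj t (e t) := by
        rw [hrest t htT htc hts _ hmem, hadj t htT htc t htT]
        simp
      intro x
      constructor
      · intro hx
        have hxv := (K.edge_mem hx).2
        rw [hKv, Finset.mem_coe, Finset.mem_union] at hxv
        rcases hxv with hxT | hxA
        · by_cases hxc : x = c
          · exact Or.inl hxc
          by_cases hxs : x ∈ s
          · exact absurd ((hleaf x hxs _).mp (K.symm hx)) (fun h => hTA c hc (h ▸ hetA))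
          have h1 := (hrest x hxT hxc hxs _ hmem).mp (K.symm hx)
          rcases (hadj t htT htc x hxT).mp h1 with h | h
          · exact Or.inr h
          · rw [h] at hxc hxs
            simp only [Finset.mem_insert] at hpt
            tauto
        · exact absurd hx (hKA _ hetA _ (Finset.mem_sdiff.mp hxA).1)
      · rintro (rfl | rfl)
        · exact K.symm hcet
        · exact K.symm htet
    obtain ⟨H, hHK, hHv, hHt, hHc, hHrest⟩ :=
      K.exists_isVertexMinor_merge htc.symm hKet (hKT c hc t htT hcs' hts)
    have hTe : ∀ x ∈ T, x ≠ e t := fun x hx h => hTA x hx (h ▸ hetA)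
    have hAc : ∀ x ∈ A, x ≠ c := fun x hx h => hTA c hc (h ▸ hx)
    have hAt : ∀ x ∈ A, x ≠ t := fun x hx h => hTA t htT (h ▸ hx)
    have hHe : ∀ x, ¬ H.Adj (e t) x := by
      intro x hx
      have := (H.edge_mem hx).1
      rw [hHv] at this
      exact this.2 rfl
    refine ⟨H, hHK.trans hKG, ?_, ?_, ?_, ?_, ?_, ?_, ?_⟩
    · rw [hHv, hKv]
      ext x
      have := hTe x
      simp only [Set.mem_sdiff, Finset.mem_union, Finset.mem_coe, Finset.mem_sdiff,
        Set.mem_singleton_iff, Finset.image_insert, Finset.mem_insert]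
      tauto
    · rw [Finset.image_insert, Finset.card_insert_of_notMem hets, hcard,
        Finset.card_insert_of_notMem hts]
    · intro x hx b
      rcases Finset.mem_insert.mp hx with rfl | hx
      · exact hHt b
      have hxT := hsT hx
      have hxc : x ≠ c := fun h => hcs' (h ▸ hx)
      have hxt : x ≠ t := fun h => hts (h ▸ hx)
      have hxe := hTe x hxT
      by_cases hbe : b = e t
      · rw [hbe]
        exact ⟨fun h => absurd (H.symm h) (hHe x), fun h => absurd h.symm (hTe c hc)⟩
      by_cases hbt : b = t
      · rw [hbt]
        constructor
        · intro h; exact absurd ((hHt x).mp (H.symm h)) hxc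
        · intro h; exact absurd h htc
      by_cases hbc : b = c
      · rw [hbc]
        simp only [iff_true]
        refine H.symm ((hHc x hxe hxt).mpr (Or.inl ⟨K.symm ((hleaf x hx c).mpr rfl), ?_⟩))
        intro h
        exact htc ((hleaf x hx t).mp (K.symm h))
      rw [hHrest x b hxc hxt hxe hbc hbt hbe, hleaf x hx]
    · intro b hb
      simp only [Finset.image_insert, Finset.mem_sdiff, Finset.mem_insert, not_or] at hb
      obtain ⟨hbA, hbe, hbs⟩ := hb
      have hmem : b ∈ A \ s.image e := by simp [hbA, hbs]
      rw [hHc b hbe (hAt b hbA), hcen b hmem, hrest t htT htc hts b hmem, Finset.insert_comm,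
        Finset.filter_insert _ t (insert c s)]
      by_cases htb : G.Adj t b
      · rw [if_pos htb, Finset.card_insert_of_notMem (by simp [htc, hts]), Nat.odd_add_one]
        simp [xor_def, htb]
      · simp [xor_def, htb]
    · intro x hxT hxc hxs b hb
      simp only [Finset.image_insert, Finset.mem_sdiff, Finset.mem_insert, not_or] at hb hxs
      obtain ⟨hbA, hbe, hbs⟩ := hb
      rw [hHrest x b hxc hxs.1 (hTe x hxT) (hAc b hbA) (hAt b hbA) hbe]
      exact hrest x hxT hxc hxs.2 b (by simp [hbA, hbs])
    · intro x hx y hy hxs hys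
      simp only [Finset.mem_insert, not_or] at hxs hys
      have hcy : ∀ y ∈ T, y ∉ s → y ≠ t → ¬ H.Adj c y := by
        intro y hy hys hyt
        rw [hHc y (hTe y hy) hyt]
        have h1 := hKT c hc y hy hcs' hys
        have h2 := hKT t htT y hy hts hys
        simp [h1, h2]
      by_cases hxc : x = c
      · exact hxc ▸ hcy y hy hys.2 hys.1
      by_cases hyc : y = c
      · exact fun h => hcy x hx hxs.2 hxs.1 (hyc ▸ H.symm h)
      rw [hHrest x y hxc hxs.1 (hTe x hx) hyc hys.1 (hTe y hy)]
      exact hKT x hx y hy hxs.2 hys.2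
    · intro x hx y hy h
      by_cases hxe : x = e t
      · exact hHe y (hxe ▸ h)
      by_cases hye : y = e t
      · exact hHe x (hye ▸ H.symm h)
      rw [hHrest x y (hAc x hx) (hAt x hx) hxe (hAc y hy) (hAt y hy) hye] at h
      exact hKA x hx y hy h

/-- In the setting of `exists_isVertexMinor_merge_finset`, if every vertex of `A` other than the
connecting vertices has an odd number of neighbours in `T`, then `G` has a star vertex-minor on
`A.card + 1` vertices. -/
theorem exists_isStar_isVertexMinor_of_tree [DecidableEq α] (G : FGraph α)
    [DecidableRel G.Adj] (T A : Finset α)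
    (c : α) (e p : α → α) (r : α → ℕ) (hdisj : Disjoint T A) (hc : c ∈ T)
    (hverts : G.verts = T ∪ A) (hT : ∀ x ∈ T, ∀ y ∈ T, ¬ G.Adj x y)
    (hA : ∀ x ∈ A, ∀ y ∈ A, ¬ G.Adj x y)
    (he : ∀ t ∈ T, t ≠ c → e t ∈ A) (hp : ∀ t ∈ T, t ≠ c → p t ∈ T)
    (hr : ∀ t ∈ T, t ≠ c → r (p t) < r t)
    (hadj : ∀ t ∈ T, t ≠ c → ∀ x ∈ T, G.Adj x (e t) ↔ x = t ∨ x = p t)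
    (hodd : ∀ a ∈ A, (∀ t ∈ T, t ≠ c → e t ≠ a) → Odd (T.filter (G.Adj · a)).card) :
    ∃ H : FGraph α, IsVertexMinor H G ∧ H.IsStar c ∧ H.verts.Finite ∧
      H.verts.ncard = A.card + 1 := by
  obtain ⟨H, hHG, hHv, hcard, hleaf, hcen, -, hHT, hHA⟩ :=
    G.exists_isVertexMinor_merge_finset T A (T.erase c) c e p r hdisj hc hverts hT hA he hr hadj
      (Finset.erase_subset _ _) (by simp)
      (by
        intro t ht
        rw [Finset.insert_erase hc]
        exact hp t (Finset.mem_of_mem_erase ht) (Finset.ne_of_mem_erase ht))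
  rw [Finset.insert_erase hc] at hcen
  have hcb : ∀ b ∈ H.verts, b ≠ c → H.Adj c b := by
    intro b hb hbc
    rw [hHv, Finset.mem_coe, Finset.mem_union] at hb
    rcases hb with hb | hb
    · exact H.symm ((hleaf b (Finset.mem_erase.mpr ⟨hbc, hb⟩) c).mpr rfl)
    · refine (hcen b hb).mpr (hodd b (Finset.mem_sdiff.mp hb).1 ?_)
      intro t ht htc hte
      exact (Finset.mem_sdiff.mp hb).2
        (Finset.mem_image.mpr ⟨t, Finset.mem_erase.mpr ⟨htc, ht⟩, hte⟩)
  have hor : ∀ a b, H.Adj a b → a = c ∨ b = c := by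
    intro a b hab
    by_contra! h
    obtain ⟨ha, hb⟩ := H.edge_mem hab
    rw [hHv, Finset.mem_coe, Finset.mem_union] at ha hb
    rcases ha with ha | ha
    · exact h.2 ((hleaf a (Finset.mem_erase.mpr ⟨h.1, ha⟩) b).mp hab)
    rcases hb with hb | hb
    · exact h.1 ((hleaf b (Finset.mem_erase.mpr ⟨h.2, hb⟩) a).mp (H.symm hab))
    exact hHA a (Finset.mem_sdiff.mp ha).1 b (Finset.mem_sdiff.mp hb).1 hab
  refine ⟨H, hHG, ⟨by simp [hHv, hc], ?_⟩, hHv ▸ Finset.finite_toSet _, ?_⟩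
  · intro a b
    constructor
    · intro hab
      exact ⟨fun h => H.loopless a (by rwa [← h] at hab), (H.edge_mem hab).1, (H.edge_mem hab).2,
        hor a b hab⟩
    · rintro ⟨hab, ha, hb, rfl | rfl⟩
      · exact hcb b hb hab.symm
      · exact H.symm (hcb a ha hab)
  · rw [hHv, Set.ncard_coe_finset, Finset.card_union_of_disjoint
      (hdisj.mono_right Finset.sdiff_subset), Finset.card_sdiff_of_subset, hcard,
      Finset.card_erase_of_mem hc]
    · have h1 : 0 < T.card := Finset.card_pos.mpr ⟨c, hc⟩
      have h2 : (T.erase c).card ≤ A.card := by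
        rw [← hcard]
        refine Finset.card_le_card ?_
        intro x hx
        obtain ⟨t, ht, rfl⟩ := Finset.mem_image.mp hx
        exact he t (Finset.mem_of_mem_erase ht) (Finset.ne_of_mem_erase ht)
      rw [Finset.card_erase_of_mem hc] at h2
      omega
    · intro x hx
      obtain ⟨t, ht, rfl⟩ := Finset.mem_image.mp hx
      exact he t (Finset.mem_of_mem_erase ht) (Finset.ne_of_mem_erase ht)

/-- A finite star has every smaller nonempty star as a vertex-minor. -/
theorem IsStar.exists_isVertexMinor_ncard {G : FGraph α} {c : α} (hG : G.IsStar c)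
    (hfin : G.verts.Finite) {N : ℕ} (hN : 0 < N) (hNle : N ≤ G.verts.ncard) :
    ∃ H : FGraph α, IsVertexMinor H G ∧ H.IsStar c ∧ H.verts.ncard = N := by
  classical
  lift G.verts to Finset α using hfin with V hV
  rw [Set.ncard_coe_finset] at hNle
  have hcV : c ∈ V := by simpa [← hV] using hG.1
  obtain ⟨W, hcW, hWV, hW⟩ := Finset.exists_subsuperset_card_eq
    (Finset.singleton_subset_iff.mpr hcV) (by rwa [Finset.card_singleton]) hNle
  have hcW := Finset.singleton_subset_iff.mp hcW
  obtain ⟨H, hHG, hHv, hadj⟩ := G.exists_isVertexMinor_delete (V \ W)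
  have hHW : H.verts = W := by
    rw [hHv, ← hV, ← Finset.coe_sdiff, Finset.sdiff_sdiff_eq_self hWV]
  refine ⟨H, hHG, ⟨by simpa [hHW] using hcW, ?_⟩, by rw [hHW, Set.ncard_coe_finset, hW]⟩
  intro a b
  rw [hadj, hG.2, hHW, ← hV]
  have ha := @hWV a
  have hb := @hWV b
  simp only [Finset.mem_coe, Finset.mem_sdiff]
  tauto

end FGraph

/-- The cells with even coordinate sum that lie in row `0` or in a column divisible by `3`. -/
def combCells (n : ℕ) : Finset (ℕ × ℕ) :=
  (Finset.range n ×ˢ Finset.range n).filter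
    fun x => (x.1 + x.2) % 2 = 0 ∧ (x.1 = 0 ∨ x.2 % 3 = 0)

/-- The cells with odd coordinate sum. -/
def oddCells (n : ℕ) : Finset (ℕ × ℕ) :=
  (Finset.range n ×ˢ Finset.range n).filter fun x => (x.1 + x.2) % 2 = 1

/-- The parent of a non-root cell in the spanning tree of `combCells n` rooted at `(0, 0)`. -/
def combParent (x : ℕ × ℕ) : ℕ × ℕ :=
  if x.1 = 0 then if x.2 % 6 = 4 then (1, x.2 - 1) else (0, x.2 - 2)
  else if x.1 = 1 then (0, x.2 - 1) else (x.1 - 2, x.2)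

/-- The odd cell joining a non-root cell of `combCells n` to its parent. -/
def combLink (x : ℕ × ℕ) : ℕ × ℕ :=
  if x.1 = 0 then if x.2 % 6 = 4 then (1, x.2) else (0, x.2 - 1)
  else if x.1 = 1 then (1, x.2 - 1) else (x.1 - 1, x.2)

theorem mem_combCells {n i j : ℕ} :
    (i, j) ∈ combCells n ↔ (i < n ∧ j < n) ∧ (i + j) % 2 = 0 ∧ (i = 0 ∨ j % 3 = 0) := by
  simp [combCells]

theorem mem_oddCells {n i j : ℕ} :
    (i, j) ∈ oddCells n ↔ (i < n ∧ j < n) ∧ (i + j) % 2 = 1 := by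
  simp [oddCells]

theorem card_oddCells_ge (m : ℕ) : 2 * m * m ≤ (oddCells (2 * m)).card := by
  have h := Finset.card_le_card_of_injOn (s := Finset.range (2 * m) ×ˢ Finset.range m)
    (t := oddCells (2 * m)) (fun x => (x.1, 2 * x.2 + (x.1 + 1) % 2))
    (by
      rintro ⟨i, j⟩ hx
      simp only [Finset.coe_product, Set.mem_prod, Finset.mem_coe, Finset.mem_range] at hx
      simp only [Finset.mem_coe, mem_oddCells]
      omega)
    (by
      rintro ⟨i, j⟩ _ ⟨i', j'⟩ _ h
      simp only [Prod.mk.injEq] at h ⊢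
      omega)
  simpa using h

theorem gridGraph_adj_mk {n i j i' j' : ℕ} : (gridGraph n).Adj (i, j) (i', j') ↔
    i < n ∧ j < n ∧ i' < n ∧ j' < n ∧
      ((i = i' ∧ (j + 1 = j' ∨ j' + 1 = j)) ∨ (j = j' ∧ (i + 1 = i' ∨ i' + 1 = i))) :=
  Iff.rfl

theorem combLink_mem_oddCells {k i j : ℕ} (hx : (i, j) ∈ combCells (6 * k + 2))
    (h0 : (i, j) ≠ (0, 0)) : combLink (i, j) ∈ oddCells (6 * k + 2) := by
  simp only [mem_combCells, ne_eq, Prod.mk.injEq] at hx h0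
  unfold combLink
  split_ifs <;> simp only [mem_oddCells] at * <;> omega

theorem combParent_mem_combCells {k i j : ℕ} (hx : (i, j) ∈ combCells (6 * k + 2))
    (h0 : (i, j) ≠ (0, 0)) : combParent (i, j) ∈ combCells (6 * k + 2) := by
  simp only [mem_combCells, ne_eq, Prod.mk.injEq] at hx h0
  unfold combParent
  split_ifs <;> simp only [mem_combCells, true_or, and_true] at * <;> omega

theorem combParent_rank_lt {n i j : ℕ} (hx : (i, j) ∈ combCells n) (h0 : (i, j) ≠ (0, 0)) :
    (combParent (i, j)).1 + 2 * (combParent (i, j)).2 < i + 2 * j := by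
  simp only [mem_combCells, ne_eq, Prod.mk.injEq] at hx h0
  unfold combParent
  split_ifs <;> dsimp only at * <;> omega

theorem gridGraph_adj_combLink {k i j i' j' : ℕ} (hx : (i, j) ∈ combCells (6 * k + 2))
    (h0 : (i, j) ≠ (0, 0)) (hy : (i', j') ∈ combCells (6 * k + 2)) :
    (gridGraph (6 * k + 2)).Adj (i', j') (combLink (i, j)) ↔
      (i', j') = (i, j) ∨ (i', j') = combParent (i, j) := by
  simp only [mem_combCells, ne_eq, Prod.mk.injEq] at hx h0 hy
  unfold combParent combLink
  split_ifs <;> simp only [gridGraph_adj_mk, Prod.mk.injEq] at * <;> omega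

open Classical in
/-- An odd cell that is not a link has one or three neighbours in the comb. -/
theorem odd_card_combCells_adj {k i j : ℕ} (ha : (i, j) ∈ oddCells (6 * k + 2))
    (hlink : ∀ t ∈ combCells (6 * k + 2), t ≠ (0, 0) → combLink t ≠ (i, j)) :
    Odd ((combCells (6 * k + 2)).filter ((gridGraph (6 * k + 2)).Adj · (i, j))).card := by
  rw [mem_oddCells] at ha
  have hone : ∀ i' j', (∀ u v, ((u, v) ∈ combCells (6 * k + 2) ∧
      (gridGraph (6 * k + 2)).Adj (u, v) (i, j)) ↔ u = i' ∧ v = j') →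
      Odd ((combCells (6 * k + 2)).filter ((gridGraph (6 * k + 2)).Adj · (i, j))).card := by
    intro i' j' h
    have : (combCells (6 * k + 2)).filter ((gridGraph (6 * k + 2)).Adj · (i, j)) = {(i', j')} := by
      ext ⟨u, v⟩
      simp only [Finset.mem_filter, h, Finset.mem_singleton, Prod.mk.injEq]
    simp [this]
  have hnot : ∀ u v, (u, v) ∈ combCells (6 * k + 2) → ¬ (u = 0 ∧ v = 0) →
      combLink (u, v) ≠ (i, j) := fun u v h h' => hlink (u, v) h (by simpa using h')
  simp only [mem_combCells, gridGraph_adj_mk] at hone hnot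
  by_cases hi0 : i = 0
  · by_cases hj : j = 6 * k + 1
    · exact hone 0 (j - 1) (by omega)
    by_cases hj3 : j % 3 = 0
    · have : (combCells (6 * k + 2)).filter ((gridGraph (6 * k + 2)).Adj · (i, j)) =
          {(0, j - 1), (0, j + 1), (1, j)} := by
        ext ⟨u, v⟩
        simp only [Finset.mem_filter, mem_combCells, gridGraph_adj_mk, Finset.mem_insert,
          Finset.mem_singleton, Prod.mk.injEq]
        omega
      rw [this, Finset.card_eq_three.mpr ⟨_, _, _, _, _, _, rfl⟩]
      · decide
      all_goals simp
    · refine absurd ?_ (hnot 0 (j + 1) (by omega) (by omega))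
      simp [combLink, hi0, show (j + 1) % 6 ≠ 4 by omega]
  by_cases hj3 : j % 3 = 0
  · by_cases hi : i = 6 * k + 1
    · exact hone (i - 1) j (by omega)
    · refine absurd ?_ (hnot (i + 1) j (by omega) (by omega))
      simp [combLink, hi0]
  by_cases hj1 : j % 3 = 1
  · by_cases hi : i = 1
    · refine absurd ?_ (hnot 0 j (by omega) (by omega))
      simp [combLink, hi, show j % 6 = 4 by omega]
    · exact hone i (j - 1) (by omega)
  · by_cases hi : i = 1
    · refine absurd ?_ (hnot 1 (j + 1) (by omega) (by omega))
      simp [combLink, hi]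
    · exact hone i (j + 1) (by omega)

/-- for `n = 6k + 2` (`k ≥ 0`), the star graph on 18 * k ^ 2 + 10 * k + 3 vertices is a
vertex-minor of the `n × n` grid graph. -/
theorem grid_star_vertexMinor_18 (k n : ℕ)  (hn : n = 6 * k + 2) :
    ∃ (H : FGraph (ℕ × ℕ)) (c : ℕ × ℕ),
      FGraph.IsVertexMinor H (gridGraph n) ∧ H.IsStar c ∧
      H.verts.ncard = 18 * k ^ 2 + 10 * k + 3 := by
  classical
  subst hn
  have hTA : Disjoint (combCells (6 * k + 2)) (oddCells (6 * k + 2)) := by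
    rw [Finset.disjoint_left]
    rintro ⟨i, j⟩ h h'
    rw [mem_combCells] at h
    rw [mem_oddCells] at h'
    omega
  obtain ⟨G, hG, hGv, hGadj⟩ := (gridGraph (6 * k + 2)).exists_isVertexMinor_delete
    ((Finset.range (6 * k + 2) ×ˢ Finset.range (6 * k + 2)) \
      (combCells (6 * k + 2) ∪ oddCells (6 * k + 2)))
  have hmem : ∀ x ∈ combCells (6 * k + 2) ∪ oddCells (6 * k + 2),
      ∀ y ∈ combCells (6 * k + 2) ∪ oddCells (6 * k + 2),
        (G.Adj x y ↔ (gridGraph (6 * k + 2)).Adj x y) := by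
    intro x hx y hy
    rw [hGadj]
    simp only [Finset.mem_sdiff, hx, hy, not_true, and_false, not_false_iff, and_true]
  have hT : ∀ x ∈ combCells (6 * k + 2), x ∈ combCells (6 * k + 2) ∪ oddCells (6 * k + 2) :=
    fun x hx => Finset.mem_union_left _ hx
  have hA : ∀ x ∈ oddCells (6 * k + 2), x ∈ combCells (6 * k + 2) ∪ oddCells (6 * k + 2) :=
    fun x hx => Finset.mem_union_right _ hx
  obtain ⟨H, hHG, hstar, hfin, hcard⟩ := G.exists_isStar_isVertexMinor_of_tree
    (combCells (6 * k + 2)) (oddCells (6 * k + 2)) (0, 0) combLink combParent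
    (fun x => x.1 + 2 * x.2) hTA (by simp [mem_combCells])
    (by
      rw [hGv]
      ext ⟨i, j⟩
      simp only [gridGraph, Set.mem_sdiff, Set.mem_ofPred_eq, Finset.mem_coe, Finset.mem_sdiff,
        Finset.mem_product, Finset.mem_range, Finset.mem_union, mem_combCells,
        mem_oddCells]
      tauto)
    (by
      rintro ⟨i, j⟩ hx ⟨i', j'⟩ hy
      rw [hmem _ (hT _ hx) _ (hT _ hy), gridGraph_adj_mk]
      rw [mem_combCells] at hx hy
      omega)
    (by
      rintro ⟨i, j⟩ hx ⟨i', j'⟩ hy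
      rw [hmem _ (hA _ hx) _ (hA _ hy), gridGraph_adj_mk]
      rw [mem_oddCells] at hx hy
      omega)
    (fun _ => combLink_mem_oddCells) (fun _ => combParent_mem_combCells)
    (fun _ => combParent_rank_lt)
    (by
      intro x hx h0 y hy
      rw [hmem _ (hT _ hy) _ (hA _ (combLink_mem_oddCells hx h0))]
      exact gridGraph_adj_combLink hx h0 hy)
    (by
      intro a ha hlink
      rw [Finset.filter_congr fun x hx => hmem x (hT x hx) a (hA a ha)]
      exact odd_card_combCells_adj ha hlink)
  have hle : 18 * k ^ 2 + 10 * k + 3 ≤ H.verts.ncard := by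
    have h := card_oddCells_ge (3 * k + 1)
    rw [show 2 * (3 * k + 1) = 6 * k + 2 by ring] at h
    rw [hcard]
    nlinarith
  obtain ⟨K, hK, hKstar, hKcard⟩ := hstar.exists_isVertexMinor_ncard hfin (by omega) hle
  exact ⟨K, (0, 0), (hK.trans hHG).trans hG, hKstar, hKcard⟩
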